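/- arXiv:2509.00929 — 8 statements merged into one kernel-verified Lean document; each statement's English description precedes it below -/
import Mathlib

section
/- If G is a finite simple graph which is 3K1-free and paraglider-free, then χ(G) ≤ max{ω(G) + 3, 2ω(G) − 2}. -/
open SimpleGraph

/-- The paraglider: a 4-cycle 0-1-2-3-0 plus a vertex 4 adjacent to 0, 1, 2. -/
def paraglider : SimpleGraph (Fin 5) :=
  SimpleGraph.fromEdgeSet {s(0,1), s(1,2), s(2,3), s(3,0), s(4,0), s(4,1), s(4,2)}

/-- An involution that moves every vertex to itself or to a neighbour: a matching, with the
unmatched vertices as fixed points. -/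
def IsMatchingMap {V : Type*} (H : SimpleGraph V) (σ : V → V) : Prop :=
  Function.Involutive σ ∧ ∀ v, σ v ≠ v → H.Adj v (σ v)

/-- A symmetric relation in which every vertex has at most one partner comes from an involution. -/
lemma exists_involutive_of_unique_partner {V : Type*} (r : V → V → Prop)
    (hsymm : ∀ u v, r u v → r v u)
    (huniq : ∀ u v w, r u v → r u w → v = w) :
    ∃ σ : V → V, Function.Involutive σ ∧ (∀ v, σ v ≠ v → r v (σ v)) ∧
      ∀ v w, r v w → σ v = w := by
  classical
  have h : ∀ v, ∃ w, r v w ∨ (w = v ∧ ∀ u, ¬ r v u) := fun v => by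
    by_cases hv : ∃ w, r v w
    · exact hv.imp fun _ => Or.inl
    · exact ⟨v, Or.inr ⟨rfl, not_exists.1 hv⟩⟩
  choose σ hσ using h
  have hr : ∀ v w, r v w → σ v = w := fun v w hvw =>
    (hσ v).elim (fun h => huniq _ _ _ h hvw) fun h => (h.2 w hvw).elim
  refine ⟨σ, fun v => ?_, fun v hv => (hσ v).resolve_right fun h => hv h.1, hr⟩
  rcases hσ v with h | h
  · exact hr _ _ (hsymm _ _ h)
  · rw [h.1, h.1]

/-- A set closed under an involution has a system of representatives for its orbits. -/
lemma exists_transversal {V : Type*} [Fintype V] [DecidableEq V] {σ : V → V}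
    (hσ : Function.Involutive σ) (S : Finset V) (hS : ∀ v ∈ S, σ v ∈ S) :
    ∃ A ⊆ S, 2 * A.card = S.card + (S.filter fun v => σ v = v).card ∧
      (∀ v ∈ A, σ v ∈ A → σ v = v) ∧ ∀ v ∈ S, v ∉ A → σ v ∈ A := by
  let e := Fintype.equivFin V
  refine ⟨S.filter fun v => e v ≤ e (σ v), Finset.filter_subset _ _, ?_, ?_, ?_⟩
  · set A := S.filter fun v => e v ≤ e (σ v) with hA
    have himg : A.image σ = S.filter fun v => e (σ v) ≤ e v := by
      ext v
      simp only [hA, Finset.mem_image, Finset.mem_filter]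
      constructor
      · rintro ⟨w, ⟨hw, hle⟩, rfl⟩
        exact ⟨hS w hw, by rwa [hσ w]⟩
      · rintro ⟨hv, hle⟩
        exact ⟨σ v, ⟨hS v hv, by rwa [hσ v]⟩, hσ v⟩
    have hcard : (A.image σ).card = A.card := Finset.card_image_of_injective _ hσ.injective
    have hunion : A ∪ A.image σ = S := by
      rw [himg, hA, ← Finset.filter_or]
      exact Finset.filter_true_of_mem fun v _ => le_total _ _
    have hinter : A ∩ A.image σ = S.filter fun v => σ v = v := by
      rw [himg, hA, ← Finset.filter_and]
      refine Finset.filter_congr fun v _ => ?_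
      rw [← le_antisymm_iff, e.injective.eq_iff, eq_comm]
    have := Finset.card_union_add_card_inter A (A.image σ)
    rw [hunion, hinter, hcard] at this
    omega
  · intro v hv hv'
    rw [Finset.mem_filter] at hv hv'
    rw [hσ v] at hv'
    exact e.injective (le_antisymm hv'.2 hv.2)
  · intro v hv hvA
    simp only [Finset.mem_filter, not_and, not_le] at hvA ⊢
    exact ⟨hS v hv, by rw [hσ v]; exact (hvA hv).le⟩

lemma colorable_compl_of_matchingMap {V : Type*} [Fintype V] [DecidableEq V] {H : SimpleGraph V}
    {σ : V → V} (hσ : IsMatchingMap H σ) {k : ℕ}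
    (hk : Fintype.card V + (Finset.univ.filter fun v => σ v = v).card ≤ 2 * k + 1) :
    Hᶜ.Colorable k := by
  obtain ⟨A, -, hcard, -, hcov⟩ := exists_transversal hσ.1 Finset.univ fun _ _ => Finset.mem_univ _
  rw [Finset.card_univ] at hcard
  let f : V → A := fun v => if h : v ∈ A then ⟨v, h⟩ else ⟨σ v, hcov v (Finset.mem_univ _) h⟩
  have hf : ∀ {u v}, Hᶜ.Adj u v → f u ≠ f v := by
    intro u v huv hfe
    rw [SimpleGraph.compl_adj] at huv
    simp only [f] at hfe
    split_ifs at hfe with hu hv hv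
    · exact huv.1 (Subtype.ext_iff.1 hfe)
    · have h : u = σ v := Subtype.ext_iff.1 hfe
      exact huv.2 (h ▸ (hσ.2 v (h ▸ huv.1)).symm)
    · have h : σ u = v := Subtype.ext_iff.1 hfe
      exact huv.2 (h ▸ hσ.2 u (h ▸ huv.1.symm))
    · exact huv.1 (hσ.1.injective (Subtype.ext_iff.1 hfe))
  have := (SimpleGraph.Coloring.mk f hf).colorable
  rw [Fintype.card_coe] at this
  exact this.mono (by omega)

lemma exists_matchingMap_of_coloring {V : Type*} [Fintype V] [DecidableEq V] {H : SimpleGraph V}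
    (htri : ∀ a b c, H.Adj a b → H.Adj b c → ¬ H.Adj a c) {k : ℕ} (C : Hᶜ.Coloring (Fin k)) :
    ∃ σ, IsMatchingMap H σ ∧
      Fintype.card V + (Finset.univ.filter fun v => σ v = v).card ≤ 2 * k ∧
      ∀ t, (∀ v, C v = C t → v = t) → σ t = t := by
  have hadj : ∀ u v, u ≠ v → C u = C v → H.Adj u v := fun u v hne hC => by
    by_contra h
    exact C.valid ((SimpleGraph.compl_adj _ _ _).2 ⟨hne, h⟩) hC
  obtain ⟨σ, hinv, hmove, hr⟩ := exists_involutive_of_unique_partner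
    (fun u v => u ≠ v ∧ C u = C v) (fun u v h => ⟨h.1.symm, h.2.symm⟩)
    (fun u v w h h' => by
      by_contra hvw
      exact htri u v w (hadj _ _ h.1 h.2) (hadj _ _ hvw (h.2.symm.trans h'.2))
        (hadj _ _ h'.1 h'.2))
  refine ⟨σ, ⟨hinv, fun v hv => hadj _ _ (hmove v hv).1 (hmove v hv).2⟩, ?_, fun t ht => ?_⟩
  · obtain ⟨A, -, hcard, hA, -⟩ := exists_transversal hinv Finset.univ fun _ _ => Finset.mem_univ _
    rw [Finset.card_univ] at hcard
    have hle : A.card ≤ (Finset.univ : Finset (Fin k)).card := by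
      refine Finset.card_le_card_of_injOn C (fun _ _ => Finset.mem_coe.2 (Finset.mem_univ _)) ?_
      intro u hu v hv huv
      by_contra hne
      have h := hr u v ⟨hne, huv⟩
      exact hne ((hA u hu (h ▸ hv)).symm.trans h)
    rw [Finset.card_fin] at hle
    omega
  · by_contra h
    exact h (ht _ (hmove t h).2.symm)

/-- The exchange step in Gallai's lemma: if `σ` and `τ` are maximum matchings, `σ` misses `u ≠ v`
and `τ` misses `t`, then some maximum matching misses `t` and one of `u`, `v`. -/
lemma IsMatchingMap.exists_exchange {V : Type*} [Fintype V] [DecidableEq V] {H : SimpleGraph V}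
    {m : ℕ} (hmin : ∀ σ, IsMatchingMap H σ → m ≤ (Finset.univ.filter fun v => σ v = v).card)
    {σ τ : V → V} (hσ : IsMatchingMap H σ) (hτ : IsMatchingMap H τ)
    (hσm : (Finset.univ.filter fun v => σ v = v).card = m)
    (hτm : (Finset.univ.filter fun v => τ v = v).card = m)
    {u v t : V} (huv : u ≠ v) (hu : σ u = u) (hv : σ v = v) (ht : τ t = t) :
    ∃ ρ, IsMatchingMap H ρ ∧ (Finset.univ.filter fun v => ρ v = v).card = m ∧
      ρ t = t ∧ (ρ u = u ∨ ρ v = v) := by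
  classical
  let s : Equiv.Perm V := hσ.1.toPerm
  let p : Equiv.Perm V := hτ.1.toPerm
  have hss : s * s = 1 := Equiv.ext hσ.1
  have hpp : p * p = 1 := Equiv.ext hτ.1
  have hsi : s⁻¹ = s := inv_eq_of_mul_eq_one_left hss
  have hpi : p⁻¹ = p := inv_eq_of_mul_eq_one_left hpp
  set g : Equiv.Perm V := s * p with hg
  have hpg : ∀ k : ℤ, p * g ^ k = g ^ (-k) * p := fun k => by
    have h : p * g * p⁻¹ = g⁻¹ := by
      rw [hg, mul_inv_rev, hpi, hsi, mul_assoc, mul_assoc, hpp, mul_one]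
    have := conj_zpow (a := p) (b := g) (i := k)
    rw [h, inv_zpow', eq_mul_inv_iff_mul_eq] at this
    exact this.symm
  have hpt : p t = t := ht
  have hpO : ∀ k : ℤ, τ ((g ^ k) t) = (g ^ (-k)) t := fun k => by
    have := congrArg (fun q : Equiv.Perm V => q t) (hpg k)
    simp only [Equiv.Perm.mul_apply, hpt] at this
    exact this
  have hsO : ∀ k : ℤ, σ ((g ^ k) t) = (g ^ (1 - k)) t := fun k => by
    have hs : s = g * p := by rw [hg, mul_assoc, hpp, mul_one]
    change s ((g ^ k) t) = _
    rw [hs, Equiv.Perm.mul_apply]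
    change g (τ _) = _
    rw [hpO, ← Equiv.Perm.mul_apply, ← zpow_one_add, sub_eq_add_neg]
  let O : V → Prop := fun w => ∃ k : ℤ, (g ^ k) t = w
  have hOσ : ∀ w, O (σ w) ↔ O w := by
    have : ∀ w, O w → O (σ w) := by
      rintro _ ⟨k, rfl⟩
      exact ⟨1 - k, (hsO k).symm⟩
    exact fun w => ⟨fun h => by simpa only [hσ.1 w] using this _ h, this w⟩
  have hOτ : ∀ w, O (τ w) ↔ O w := by
    have : ∀ w, O w → O (τ w) := by
      rintro _ ⟨k, rfl⟩
      exact ⟨-k, (hpO k).symm⟩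
    exact fun w => ⟨fun h => by simpa only [hτ.1 w] using this _ h, this w⟩
  have hnot : ¬ (O u ∧ O v) := by
    rintro ⟨⟨k, rfl⟩, ⟨l, rfl⟩⟩
    apply huv
    have hstab : ∀ j : ℤ, σ ((g ^ j) t) = (g ^ j) t → g ^ (2 * j - 1) ∈ MulAction.stabilizer _ t :=
      fun j hj => by
        rw [hsO] at hj
        rw [MulAction.mem_stabilizer_iff, Equiv.Perm.smul_def,
          show 2 * j - 1 = -(1 - j) + j by ring, zpow_add, Equiv.Perm.mul_apply, ← hj,
          ← Equiv.Perm.mul_apply, ← zpow_add, neg_add_cancel, zpow_zero, Equiv.Perm.one_apply]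
    have hk := hstab k hu
    have hl := hstab l hv
    have h1 := mul_mem hk (inv_mem hl)
    have h2 := mul_mem (zpow_mem h1 k) (inv_mem (zpow_mem hk (k - l)))
    have h3 : g ^ (k - l) ∈ MulAction.stabilizer (Equiv.Perm V) t := by
      convert h2 using 1
      rw [← zpow_neg, ← zpow_add, ← zpow_mul, ← zpow_mul, ← zpow_neg, ← zpow_add]
      congr 1
      ring
    rw [MulAction.mem_stabilizer_iff, Equiv.Perm.smul_def] at h3
    calc (g ^ k) t = (g ^ (l + (k - l))) t := by rw [add_sub_cancel]
      _ = (g ^ l) t := by rw [zpow_add, Equiv.Perm.mul_apply, h3]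
  have hglue : ∀ {a b : V → V}, IsMatchingMap H a → IsMatchingMap H b →
      (∀ w, O (a w) ↔ O w) → (∀ w, O (b w) ↔ O w) →
      IsMatchingMap H fun w => if O w then a w else b w := by
    intro a b ha hb hOa hOb
    refine ⟨fun w => ?_, fun w => ?_⟩
    · by_cases hw : O w
      · simp only [hw, if_true, hOa, ha.1 w]
      · simp only [hw, if_false, hOb, hb.1 w]
    · by_cases hw : O w
      · simpa only [hw, if_true] using ha.2 w
      · simpa only [hw, if_false] using hb.2 w
  have h1 := hglue hτ hσ hOτ hOσ
  have h2 := hglue hσ hτ hOσ hOτ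
  have hsum : (Finset.univ.filter fun w => (if O w then τ w else σ w) = w).card +
      (Finset.univ.filter fun w => (if O w then σ w else τ w) = w).card = m + m := by
    trans (Finset.univ.filter fun v => σ v = v).card + (Finset.univ.filter fun v => τ v = v).card
    swap
    · rw [hσm, hτm]
    simp only [Finset.card_filter, ← Finset.sum_add_distrib]
    refine Finset.sum_congr rfl fun w _ => ?_
    by_cases hw : O w
    · simp only [hw, if_true, add_comm]
    · simp only [hw, if_false]
  have hm1 := hmin _ h1
  have hm2 := hmin _ h2
  refine ⟨_, h1, by omega, ?_, ?_⟩
  · have : O t := ⟨0, by simp⟩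
    simp only [this, if_true, ht]
  · rcases not_and_or.1 hnot with h | h
    · left; simp only [h, if_false, hu]
    · right; simp only [h, if_false, hv]

/-- Two vertices missed by a common maximum matching cannot be joined, when every vertex is missed
by some maximum matching (Gallai's lemma). -/
lemma not_reachable_of_fixed {V : Type*} [Fintype V] [DecidableEq V] {H : SimpleGraph V}
    {m : ℕ} (hmin : ∀ σ, IsMatchingMap H σ → m ≤ (Finset.univ.filter fun v => σ v = v).card)
    (hmiss : ∀ t, ∃ τ, IsMatchingMap H τ ∧ (Finset.univ.filter fun v => τ v = v).card = m ∧ τ t = t)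
    {u v : V} (huv : u ≠ v) (hreach : H.Reachable u v) :
    ∀ σ, IsMatchingMap H σ → (Finset.univ.filter fun v => σ v = v).card = m →
      σ u = u → σ v ≠ v := by
  have hadj : ∀ {a b}, H.Adj a b → ∀ σ, IsMatchingMap H σ →
      (Finset.univ.filter fun v => σ v = v).card = m → σ a = a → σ b ≠ b := by
    intro a b hab σ hσ hm ha hb
    have hswap : IsMatchingMap H fun w => if w = a then b else if w = b then a else σ w := by
      have hne := hab.ne
      have hinj := hσ.1.injective
      refine ⟨fun w => ?_, fun w => ?_⟩
      · have h1 : σ w = a → w = a := fun h => hinj (h.trans ha.symm)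
        have h2 : σ w = b → w = b := fun h => hinj (h.trans hb.symm)
        have h3 := hσ.1 w
        dsimp only
        split_ifs <;> simp_all
      · have h := hσ.2 w
        dsimp only
        split_ifs with h1 h2
        · subst h1; exact fun _ => hab
        · subst h2; exact fun _ => hab.symm
        · exact h
    have hlt : (Finset.univ.filter fun w =>
        (if w = a then b else if w = b then a else σ w) = w).card <
        (Finset.univ.filter fun v => σ v = v).card := by
      refine Finset.card_lt_card (Finset.ssubset_iff_of_subset ?_ |>.2 ⟨a, ?_, ?_⟩)
      · intro w
        have hne := hab.ne
        simp only [Finset.mem_filter, Finset.mem_univ, true_and]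
        split_ifs with h1 h2
        · subst h1; exact fun h => (hne h.symm).elim
        · subst h2; exact fun h => (hne h).elim
        · exact id
      · simpa using ha
      · simpa using hab.ne'
    have := hmin _ hswap
    omega
  obtain ⟨p⟩ := hreach
  induction p with
  | nil => exact (huv rfl).elim
  | @cons u t v hut q ih =>
    intro σ hσ hm hu hv
    by_cases htv : t = v
    · subst htv; exact hadj hut σ hσ hm hu hv
    · obtain ⟨τ, hτ, hτm, hτt⟩ := hmiss t
      obtain ⟨ρ, hρ, hρm, hρt, h | h⟩ := hσ.exists_exchange hmin hτ hm hτm huv hu hv hτt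
      · exact hadj hut ρ hρ hρm h hρt
      · exact ih htv ρ hρ hρm hρt h

lemma exists_indep_of_unique_neighbor {V : Type*} [Fintype V] [DecidableEq V] {H : SimpleGraph V}
    (M : Finset V) (hM : ∀ u ∈ M, ∀ v ∈ M, ∀ w ∈ M, H.Adj u v → H.Adj u w → v = w) :
    ∃ σ : V → V, Function.Involutive σ ∧
      (∀ v, σ v ≠ v → v ∈ M ∧ σ v ∈ M ∧ H.Adj v (σ v)) ∧
      (∀ v ∈ M, ∀ w ∈ M, H.Adj v w → σ v = w) ∧
      ∃ T ⊆ M, (∀ u ∈ T, ∀ v ∈ T, ¬ H.Adj u v) ∧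
        2 * T.card = M.card + (M.filter fun v => σ v = v).card := by
  obtain ⟨σ, hinv, hmove, hr⟩ := exists_involutive_of_unique_partner
    (fun u v => u ∈ M ∧ v ∈ M ∧ H.Adj u v) (fun u v h => ⟨h.2.1, h.1, h.2.2.symm⟩)
    (fun u v w h h' => hM u h.1 v h.2.1 w h'.2.1 h.2.2 h'.2.2)
  have hr' : ∀ v ∈ M, ∀ w ∈ M, H.Adj v w → σ v = w := fun v hv w hw h => hr v w ⟨hv, hw, h⟩
  obtain ⟨T, hTM, hcard, hT, -⟩ := exists_transversal hinv M fun v hv => by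
    by_cases h : σ v = v
    · rwa [h]
    · exact (hmove v h).2.1
  refine ⟨σ, hinv, hmove, hr', T, hTM, fun u hu v hv huv => ?_, hcard⟩
  have h := hr' u (hTM hu) v (hTM hv) huv
  exact huv.ne ((hT u hu (h ▸ hv)).symm.trans h)

/-- The common non-neighbours of the ends of an edge induce a matching plus isolated vertices. -/
lemma exists_matching_on_nonneighbors {V : Type*} [Fintype V] [DecidableEq V] {H : SimpleGraph V}
    [DecidableRel H.Adj] {α : ℕ}
    (htri : ∀ a b c, H.Adj a b → H.Adj b c → ¬ H.Adj a c)
    (hK : ∀ a b c x y, a ≠ c → H.Adj a b → H.Adj b c → H.Adj x y →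
      ¬ H.Adj a x → ¬ H.Adj a y → ¬ H.Adj b x → ¬ H.Adj b y → ¬ H.Adj c x → ¬ H.Adj c y → False)
    (hind : ∀ s : Finset V, (∀ u ∈ s, ∀ v ∈ s, ¬ H.Adj u v) → s.card ≤ α)
    {x y : V} (hxy : H.Adj x y) :
    ∃ M : Finset V, (∀ v, v ∈ M ↔ ¬ H.Adj x v ∧ ¬ H.Adj y v) ∧
      (H.neighborFinset x).card + (H.neighborFinset y).card + M.card = Fintype.card V ∧
      ∃ σ : V → V, Function.Involutive σ ∧
        (∀ v, σ v ≠ v → v ∈ M ∧ σ v ∈ M ∧ H.Adj v (σ v)) ∧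
        (∀ v ∈ M, ∀ w ∈ M, H.Adj v w → σ v = w) ∧
        ∃ t, t + 1 ≤ α ∧ 2 * t = M.card + (M.filter fun v => σ v = v).card := by
  have hmem : ∀ v, v ∈ (H.neighborFinset x ∪ H.neighborFinset y)ᶜ ↔ ¬ H.Adj x v ∧ ¬ H.Adj y v := by
    simp
  refine ⟨(H.neighborFinset x ∪ H.neighborFinset y)ᶜ, hmem, ?_, ?_⟩
  · rw [← Finset.card_union_of_disjoint, Finset.card_add_card_compl]
    rw [Finset.disjoint_left]
    intro v hv hv'
    rw [SimpleGraph.mem_neighborFinset] at hv hv'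
    exact htri x y v hxy hv' hv
  · obtain ⟨σ, hinv, hmove, hr, T, hTM, hT, hcard⟩ := exists_indep_of_unique_neighbor (H := H)
      (H.neighborFinset x ∪ H.neighborFinset y)ᶜ (fun u hu v hv w hw huv huw => by
        rw [hmem] at hu hv hw
        by_contra hne
        exact hK v u w x y hne huv.symm huw hxy (fun h => hv.1 h.symm) (fun h => hv.2 h.symm)
          (fun h => hu.1 h.symm) (fun h => hu.2 h.symm) (fun h => hw.1 h.symm)
          (fun h => hw.2 h.symm))
    refine ⟨σ, hinv, hmove, hr, T.card, ?_, hcard⟩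
    have hxT : x ∉ T := fun h => ((hmem x).1 (hTM h)).2 hxy.symm
    rw [← Finset.card_insert_of_notMem hxT]
    have hx : ∀ v ∈ T, ¬ H.Adj x v := fun v hv => ((hmem v).1 (hTM hv)).1
    refine hind _ fun u hu v hv => ?_
    rcases Finset.mem_insert.1 hu with rfl | huT <;> rcases Finset.mem_insert.1 hv with rfl | hvT
    · exact H.irrefl
    · exact hx v hvT
    · exact fun h => hx u huT h.symm
    · exact hT u huT v hvT

/-- A `K₂ + P₃`-free triangle-free graph without isolated vertices and of independence number at
most `α` has fewer than `max (2α + 7) (4α - 3)` vertices. -/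
lemma card_bound {V : Type*} [Fintype V] {H : SimpleGraph V} {α : ℕ}
    (htri : ∀ a b c, H.Adj a b → H.Adj b c → ¬ H.Adj a c)
    (hK : ∀ a b c x y, a ≠ c → H.Adj a b → H.Adj b c → H.Adj x y →
      ¬ H.Adj a x → ¬ H.Adj a y → ¬ H.Adj b x → ¬ H.Adj b y → ¬ H.Adj c x → ¬ H.Adj c y → False)
    (hind : ∀ s : Finset V, (∀ u ∈ s, ∀ v ∈ s, ¬ H.Adj u v) → s.card ≤ α)
    (hiso : ∀ v, ∃ w, H.Adj v w)
    (hn : 2 * α + 7 ≤ Fintype.card V) (hn' : 4 * α ≤ Fintype.card V + 3) : False := by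
  classical
  have hdeg : ∀ v, (H.neighborFinset v).card ≤ α := fun v => hind _ fun u hu w hw => by
    rw [SimpleGraph.mem_neighborFinset] at hu hw
    exact fun h => htri v u w hu h hw
  have hdeg' : ∀ v, α ≤ (H.neighborFinset v).card + 1 := fun v => by
    obtain ⟨w, hw⟩ := hiso v
    obtain ⟨M, -, hM, σ, -, -, -, t, ht, ht'⟩ := exists_matching_on_nonneighbors htri hK hind hw
    have := hdeg w
    omega
  obtain ⟨x⟩ : Nonempty V := Fintype.card_pos_iff.1 (by omega)
  obtain ⟨y, hxy⟩ := hiso x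
  obtain ⟨M, hM, hcard, σ, hinv, hmove, hr, t, ht, ht'⟩ :=
    exists_matching_on_nonneighbors htri hK hind hxy
  have hx := hdeg x
  have hy := hdeg y
  set I := M.filter fun v => σ v = v with hI
  set E := M.filter fun v => ¬ σ v = v with hE
  have hIE : I.card + E.card = M.card := Finset.card_filter_add_card_filter_not _
  set W := (H.neighborFinset x).erase y ∪ (H.neighborFinset y).erase x with hW
  have hmemW : ∀ v, v ∈ W ↔ (v ≠ y ∧ H.Adj x v) ∨ (v ≠ x ∧ H.Adj y v) := by simp [hW]
  have hWcard : W.card + 2 = (H.neighborFinset x).card + (H.neighborFinset y).card := by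
    have hy1 := Finset.card_erase_add_one ((H.mem_neighborFinset x y).2 hxy)
    have hx1 := Finset.card_erase_add_one ((H.mem_neighborFinset y x).2 hxy.symm)
    rw [hW, Finset.card_union_of_disjoint]
    · omega
    · rw [Finset.disjoint_left]
      intro v hv hv'
      simp only [Finset.mem_erase, SimpleGraph.mem_neighborFinset] at hv hv'
      exact htri x y v hxy hv'.2 hv.2
  have hWM : ∀ v ∈ W, v ∉ M := fun v hv hvM => by
    rw [hM] at hvM
    rcases (hmemW v).1 hv with h | h
    · exact hvM.1 h.2
    · exact hvM.2 h.2
  have hWE : ∀ w ∈ W, ∀ v ∈ E, H.Adj w v ∨ H.Adj w (σ v) := by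
    intro w hw v hv
    obtain ⟨-, hv'⟩ := Finset.mem_filter.1 hv
    obtain ⟨h1, h2, h3⟩ := hmove v hv'
    rw [hM] at h1 h2
    by_contra! h
    rcases (hmemW w).1 hw with h' | h'
    · exact hK w x y v (σ v) h'.1 h'.2.symm hxy h3 h.1 h.2 h1.1 h2.1 h1.2 h2.2
    · exact hK w y x v (σ v) h'.1 h'.2.symm hxy.symm h3 h.1 h.2 h1.2 h2.2 h1.1 h2.1
  have hWdeg : ∀ w ∈ W, 2 * (H.neighborFinset w ∩ (W ∪ I)).card + E.card + 2 ≤ 2 * α := by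
    intro w hw
    set D := H.neighborFinset w ∩ E with hD
    have hED : E.card ≤ D.card + D.card := by
      have hsub : E ⊆ D ∪ D.image σ := by
        intro v hv
        rw [Finset.mem_union]
        refine (hWE w hw v hv).imp (fun h => ?_) (fun h => ?_)
        · exact Finset.mem_inter.2 ⟨(H.mem_neighborFinset w v).2 h, hv⟩
        · have hv' := (Finset.mem_filter.1 hv).2
          refine Finset.mem_image.2 ⟨σ v, Finset.mem_inter.2
            ⟨(H.mem_neighborFinset w _).2 h, Finset.mem_filter.2 ⟨(hmove v hv').2.1, ?_⟩⟩, hinv v⟩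
          rw [hinv v]
          exact fun h => hv' h.symm
      exact (Finset.card_le_card hsub).trans ((Finset.card_union_le _ _).trans
        (Nat.add_le_add_left Finset.card_image_le _))
    obtain ⟨z, hz, hwz⟩ : ∃ z, (z = x ∨ z = y) ∧ H.Adj w z := by
      rcases (hmemW w).1 hw with h | h
      · exact ⟨x, Or.inl rfl, h.2.symm⟩
      · exact ⟨y, Or.inr rfl, h.2.symm⟩
    have hzW : z ∉ W := by
      rw [hmemW]
      rcases hz with rfl | rfl <;> simp
    have hzM : z ∉ M := by
      rw [hM]
      rcases hz with rfl | rfl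
      · exact fun h => h.2 hxy.symm
      · exact fun h => h.1 hxy
    have hdisj : Disjoint D (H.neighborFinset w ∩ (W ∪ I)) := by
      rw [Finset.disjoint_left]
      intro v hv hv'
      have hvE := Finset.mem_filter.1 (Finset.mem_inter.1 hv).2
      rcases Finset.mem_union.1 (Finset.mem_inter.1 hv').2 with h | h
      · exact hWM v h hvE.1
      · exact hvE.2 (Finset.mem_filter.1 h).2
    have hzD : z ∉ D ∪ H.neighborFinset w ∩ (W ∪ I) := by
      intro h
      rcases Finset.mem_union.1 h with h | h
      · exact hzM (Finset.mem_filter.1 (Finset.mem_inter.1 h).2).1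
      · rcases Finset.mem_union.1 (Finset.mem_inter.1 h).2 with h | h
        · exact hzW h
        · exact hzM (Finset.mem_filter.1 h).1
    have hle : (insert z (D ∪ H.neighborFinset w ∩ (W ∪ I))).card ≤ (H.neighborFinset w).card := by
      refine Finset.card_le_card (Finset.insert_subset ((H.mem_neighborFinset w z).2 hwz) ?_)
      exact Finset.union_subset Finset.inter_subset_left Finset.inter_subset_left
    rw [Finset.card_insert_of_notMem hzD, Finset.card_union_of_disjoint hdisj] at hle
    have := hdeg w
    omega
  rcases I.eq_empty_or_nonempty with hI0 | ⟨i, hi⟩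
  · rw [hI0, Finset.card_empty] at hIE ht'
    have hWind : W.card ≤ α := hind W fun u hu v hv huv => by
      have h1 := hWdeg u hu
      have h2 : 0 < (H.neighborFinset u ∩ (W ∪ I)).card := Finset.card_pos.2
        ⟨v, Finset.mem_inter.2 ⟨(H.mem_neighborFinset u v).2 huv, Finset.mem_union_left _ hv⟩⟩
      omega
    omega
  · have hIpos : 0 < I.card := Finset.card_pos.2 ⟨i, hi⟩
    have hiM := (Finset.mem_filter.1 hi).1
    have hone : ∀ w ∈ W, (H.neighborFinset w ∩ (W ∪ I)).card ≤ 1 := fun w hw => by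
      have := hWdeg w hw
      omega
    have huniq : ∀ w ∈ W, ∀ u ∈ W ∪ I, ∀ v ∈ W ∪ I, H.Adj w u → H.Adj w v → u = v :=
      fun w hw u hu v hv hwu hwv => Finset.card_le_one.1 (hone w hw) u
        (Finset.mem_inter.2 ⟨(H.mem_neighborFinset w u).2 hwu, hu⟩) v
        (Finset.mem_inter.2 ⟨(H.mem_neighborFinset w v).2 hwv, hv⟩)
    obtain ⟨τ, -, hτ, -, T, -, hT, hTcard⟩ := exists_indep_of_unique_neighbor (H := H) W
      fun u hu v hv w hw => huniq u hu v (Finset.mem_union_left _ hv) w (Finset.mem_union_left _ hw)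
    have hfix : H.neighborFinset i ⊆ W.filter fun v => τ v = v := by
      intro v hv
      rw [SimpleGraph.mem_neighborFinset] at hv
      have hiM' := (hM i).1 hiM
      have hvM : v ∉ M := fun hvM =>
        hv.ne ((Finset.mem_filter.1 hi).2.symm.trans (hr i hiM v hvM hv))
      have hvW : v ∈ W := by
        rw [hM] at hvM
        rw [hmemW]
        by_cases hxv : H.Adj x v
        · exact Or.inl ⟨fun h => hiM'.2 (h ▸ hv.symm), hxv⟩
        · exact Or.inr ⟨fun h => hiM'.1 (h ▸ hv.symm), by tauto⟩
      refine Finset.mem_filter.2 ⟨hvW, ?_⟩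
      by_contra hne
      obtain ⟨-, h1, h2⟩ := hτ v hne
      have := huniq v hvW (τ v) (Finset.mem_union_left _ h1) i (Finset.mem_union_right _ hi)
        h2 hv.symm
      exact hWM _ h1 (this ▸ hiM)
    have h1 := Finset.card_le_card hfix
    have h2 := hdeg' i
    have h3 := hind T hT
    omega

lemma exists_coloring_extend {V : Type*} {H : SimpleGraph V} {t : V} {k : ℕ}
    (h : (H.comap (Subtype.val : {v // v ≠ t} → V))ᶜ.Colorable k) :
    ∃ C : Hᶜ.Coloring (Fin (k + 1)), ∀ v, C v = C t → v = t := by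
  classical
  obtain ⟨C⟩ := h
  let f : V → Fin (k + 1) := fun v => if h : v ≠ t then (C ⟨v, h⟩).castSucc else Fin.last k
  have hf : ∀ v, f v = f t → v = t := by
    intro v hv
    by_contra hne
    simp [f, hne, (Fin.castSucc_lt_last _).ne] at hv
  refine ⟨SimpleGraph.Coloring.mk f fun {u v} huv hfe => ?_, hf⟩
  by_cases hv : v = t
  · subst hv
    exact huv.ne (hf u hfe)
  by_cases hu : u = t
  · subst hu
    exact hv (hf v hfe.symm)
  simp only [f, ne_eq, hu, hv, not_false_eq_true, dif_pos, Fin.castSucc_inj] at hfe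
  refine C.valid ?_ hfe
  rw [SimpleGraph.compl_adj] at huv ⊢
  exact ⟨fun h => huv.1 (Subtype.ext_iff.1 h), huv.2⟩

lemma colorable_compl (n : ℕ) : ∀ {V : Type*} [Fintype V] (H : SimpleGraph V) (α : ℕ),
    Fintype.card V = n →
    (∀ a b c, H.Adj a b → H.Adj b c → ¬ H.Adj a c) →
    (∀ a b c x y, a ≠ c → H.Adj a b → H.Adj b c → H.Adj x y →
      ¬ H.Adj a x → ¬ H.Adj a y → ¬ H.Adj b x → ¬ H.Adj b y → ¬ H.Adj c x → ¬ H.Adj c y → False) →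
    (∀ s : Finset V, (∀ u ∈ s, ∀ v ∈ s, ¬ H.Adj u v) → s.card ≤ α) →
    Hᶜ.Colorable (max (α + 3) (2 * α - 2)) := by
  induction n using Nat.strong_induction_on with
  | _ n ih =>
  intro V _ H α hcard htri hK hind
  classical
  by_contra hno
  set k := max (α + 3) (2 * α - 2) with hk
  have hdel : ∀ (t : V) (β : ℕ),
      (∀ s : Finset V, t ∉ s → (∀ u ∈ s, ∀ v ∈ s, ¬ H.Adj u v) → s.card ≤ β) →
      (H.comap (Subtype.val : {v // v ≠ t} → V))ᶜ.Colorable (max (β + 3) (2 * β - 2)) := by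
    intro t β hβ
    refine ih _ (hcard ▸ Fintype.card_subtype_lt (x := t) (by simp)) _ β rfl
      (fun a b c => htri a b c) (fun a b c x y hac => hK a b c x y fun h => hac (Subtype.ext h))
      fun s hs => ?_
    rw [← Finset.card_map (Function.Embedding.subtype _)]
    refine hβ _ (by simp) fun u hu v hv => ?_
    obtain ⟨u, hus, rfl⟩ := Finset.mem_map.1 hu
    obtain ⟨v, hvs, rfl⟩ := Finset.mem_map.1 hv
    exact hs u hus v hvs
  have hiso : ∀ v, ∃ w, H.Adj v w := by
    by_contra! h
    obtain ⟨v, hv⟩ := h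
    have hins : ∀ s : Finset V, v ∉ s → (∀ u ∈ s, ∀ w ∈ s, ¬ H.Adj u w) → s.card + 1 ≤ α := by
      intro s hvs hs
      rw [← Finset.card_insert_of_notMem hvs]
      refine hind _ fun a ha b hb => ?_
      rcases Finset.mem_insert.1 ha with rfl | ha
      · exact hv b
      rcases Finset.mem_insert.1 hb with rfl | hb
      · exact fun h => hv a h.symm
      · exact hs a ha b hb
    have hpos := hins ∅ (by simp) (by simp)
    obtain ⟨C, -⟩ := exists_coloring_extend (hdel v (α - 1) fun s hvs hs => by
      have := hins s hvs hs
      omega)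
    exact hno (SimpleGraph.Colorable.mono (by omega) ⟨C⟩)
  have hmatch : ∀ t : V, ∃ τ, IsMatchingMap H τ ∧
      Fintype.card V + (Finset.univ.filter fun v => τ v = v).card ≤ 2 * (k + 1) ∧ τ t = t := by
    intro t
    obtain ⟨C, hC⟩ := exists_coloring_extend (hdel t α fun s _ => hind s)
    obtain ⟨τ, hτ, hτc, hτt⟩ := exists_matchingMap_of_coloring htri C
    exact ⟨τ, hτ, hτc, hτt t hC⟩
  have hlow : ∀ σ, IsMatchingMap H σ →
      2 * (k + 1) ≤ Fintype.card V + (Finset.univ.filter fun v => σ v = v).card := by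
    intro σ hσ
    by_contra h
    exact hno (colorable_compl_of_matchingMap hσ (by omega))
  rcases isEmpty_or_nonempty V with hV | ⟨⟨t₀⟩⟩
  · exact hno (SimpleGraph.Colorable.of_isEmpty _)
  obtain ⟨σ, hσ, hσc, -⟩ := hmatch t₀
  obtain ⟨m, hm⟩ : ∃ m, (Finset.univ.filter fun v => σ v = v).card = m := ⟨_, rfl⟩
  have hσl := hlow σ hσ
  have hsep : ∀ {u v}, u ≠ v → H.Reachable u v → σ u = u → σ v ≠ v := fun huv hr =>
    not_reachable_of_fixed (m := m) (fun τ hτ => by have := hlow τ hτ; omega)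
      (fun t => by
        obtain ⟨τ, hτ, hτc, hτt⟩ := hmatch t
        have := hlow τ hτ
        exact ⟨τ, hτ, by omega, hτt⟩) huv hr σ hσ hm
  have hfix : (Finset.univ.filter fun v => σ v = v).card ≤ 1 := by
    refine Finset.card_le_one.2 fun u hu v hv => ?_
    simp only [Finset.mem_filter, Finset.mem_univ, true_and] at hu hv
    by_contra huv
    obtain ⟨u', hu'⟩ := hiso u
    obtain ⟨v', hv'⟩ := hiso v
    have hne := hsep hu'.ne hu'.reachable hu
    have hu'' := hσ.2 u' hne
    have hfar : ∀ {a b}, H.Reachable u a → H.Reachable v b → ¬ H.Adj a b := fun ha hb hab =>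
      hsep huv (ha.trans (hab.reachable.trans hb.symm)) hu hv
    have h1 := hu'.reachable
    have h2 := h1.trans hu''.reachable
    have h0 : H.Reachable u u := SimpleGraph.Reachable.refl _
    have g0 : H.Reachable v v := SimpleGraph.Reachable.refl _
    have g1 := hv'.reachable
    refine hK u u' (σ u') v v' (fun h => hu'.ne ?_) hu' hu'' hv' (hfar h0 g0) (hfar h0 g1)
      (hfar h1 g0) (hfar h1 g1) (hfar h2 g0) (hfar h2 g1)
    rw [← hu, h, hσ.1 u']
  exact card_bound htri hK hind hiso (by omega) (by omega)

/-- If `G` is a finite simple graph with no independent set of size 3 (`3K1`-free) and with no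
induced subgraph isomorphic to the paraglider, then `χ(G) ≤ max (ω(G) + 3) (2ω(G) - 2)`. -/
theorem stmt0 {V : Type*} [Fintype V] (G : SimpleGraph V)
    (h3K1 : ∀ a b c : V, a ≠ b → a ≠ c → b ≠ c →
      ¬G.Adj a b → ¬G.Adj a c → ¬G.Adj b c → False)
    (hpara : ¬ Nonempty (paraglider ↪g G)) :
    G.chromaticNumber ≤ (max (G.cliqueNum + 3) (2 * G.cliqueNum - 2) : ℕ) := by
  rw [SimpleGraph.chromaticNumber_le_iff_colorable, ← compl_compl G]
  nth_rewrite 2 3 [compl_compl G]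
  have htri : ∀ a b c, Gᶜ.Adj a b → Gᶜ.Adj b c → ¬ Gᶜ.Adj a c := by
    intro a b c hab hbc hac
    rw [SimpleGraph.compl_adj] at hab hbc hac
    exact h3K1 a b c hab.1 hac.1 hbc.1 hab.2 hac.2 hbc.2
  refine colorable_compl _ Gᶜ G.cliqueNum rfl htri ?_ ?_
  · intro a b c x y hac hab hbc hxy hax hay hbx hby hcx hcy
    have hadj : ∀ {u v}, u ≠ v → ¬ Gᶜ.Adj u v → G.Adj u v := fun huv h => by
      rw [SimpleGraph.compl_adj] at h
      tauto
    have hac' := hadj hac (htri a b c hab hbc)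
    have nax : a ≠ x := fun h => hay (h ▸ hxy)
    have nay : a ≠ y := fun h => hax (h ▸ hxy.symm)
    have nbx : b ≠ x := fun h => hby (h ▸ hxy)
    have nby : b ≠ y := fun h => hbx (h ▸ hxy.symm)
    have ncx : c ≠ x := fun h => hcy (h ▸ hxy)
    have ncy : c ≠ y := fun h => hcx (h ▸ hxy.symm)
    have gax := hadj nax hax
    have gay := hadj nay hay
    have gbx := hadj nbx hbx
    have gby := hadj nby hby
    have gcx := hadj ncx hcx
    have gcy := hadj ncy hcy
    have nab := hab.ne
    have nbc := hbc.ne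
    have nxy := hxy.ne
    have gab := ((SimpleGraph.compl_adj _ _ _).1 hab).2
    have gba := ((SimpleGraph.compl_adj _ _ _).1 hab.symm).2
    have gbc := ((SimpleGraph.compl_adj _ _ _).1 hbc).2
    have gcb := ((SimpleGraph.compl_adj _ _ _).1 hbc.symm).2
    have gxy := ((SimpleGraph.compl_adj _ _ _).1 hxy).2
    have gyx := ((SimpleGraph.compl_adj _ _ _).1 hxy.symm).2
    let f : Fin 5 → V := ![x, a, y, b, c]
    have hf : Function.Injective f := by
      intro i j hij
      fin_cases i <;> fin_cases j <;>
        simp [f, nxy, nax, nay, nab, hac, nbx, nby, nbc, ncx, ncy, nxy.symm, nax.symm, nay.symm,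
          nab.symm, hac.symm, nbx.symm, nby.symm, nbc.symm, ncx.symm, ncy.symm] at hij ⊢
    refine hpara ⟨⟨⟨f, hf⟩, fun {i j} => ?_⟩⟩
    fin_cases i <;> fin_cases j <;>
      simp [f, paraglider, hac', gax, gay, gbx, gby, gcx, gcy, hac'.symm, gax.symm, gay.symm,
        gbx.symm, gby.symm, gcx.symm, gcy.symm, gab, gbc, gxy, gba, gcb, gyx]
  · intro s hs
    refine SimpleGraph.IsClique.card_le_cliqueNum (t := s) (tc := fun u hu v hv huv => ?_)
    have := hs u hu v hv
    rw [SimpleGraph.compl_adj] at this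
    tauto
end

section
/- If G is a finite simple graph on n vertices which is 3K1-free and paraglider-free, then ω(G) ≥ (n − 1)/3, i.e. 3·ω(G) ≥ n − 1. -/
open SimpleGraph

namespace SimpleGraph

variable {V ι : Type*} {H : SimpleGraph V}

/-- `H` has no induced disjoint union of an edge and a path on three vertices. -/
def EdgePathFree (H : SimpleGraph V) : Prop :=
  ∀ a b c d e : V, H.Adj a b → H.Adj c d → H.Adj d e → c ≠ e → ¬H.Adj c e →
    ¬H.Adj a c → ¬H.Adj a d → ¬H.Adj a e → ¬H.Adj b c → ¬H.Adj b d → ¬H.Adj b e → False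

/-- `H` has no three pairwise adjacent vertices. -/
def TriangleFree (H : SimpleGraph V) : Prop :=
  ∀ a b c : V, H.Adj a b → H.Adj a c → H.Adj b c → False

/-- The edges `e i false — e i true` form an induced matching of `H`. -/
def IsInducedMatching (H : SimpleGraph V) (e : ι → Bool → V) : Prop :=
  ∀ i b j c, H.Adj (e i b) (e j c) ↔ i = j ∧ b ≠ c

/-- In each edge of `e`, the vertex `w` is adjacent to exactly the end selected by `g`. -/
def HasSignature (H : SimpleGraph V) (e : ι → Bool → V) (w : V) (g : ι → Bool) : Prop :=
  ∀ i b, H.Adj w (e i b) ↔ g i = b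

lemma IsInducedMatching.injective {e : ι → Bool → V} (he : H.IsInducedMatching e) :
    Function.Injective (Function.uncurry e) := by
  rintro ⟨i, b⟩ ⟨j, c⟩ h
  simp only [Function.uncurry_apply_pair] at h
  have h1 := he i b j (!c)
  rw [h] at h1
  have h2 := (he j c j (!c)).2 ⟨rfl, by simp⟩
  obtain ⟨rfl, hb⟩ := h1.1 h2
  cases b <;> cases c <;> simp_all

lemma IsInducedMatching.cons {k : ℕ} {e : Fin k → Bool → V} (he : H.IsInducedMatching e)
    {x y : V} (hxy : H.Adj x y) (hx : ∀ i b, ¬H.Adj x (e i b)) (hy : ∀ i b, ¬H.Adj y (e i b)) :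
    H.IsInducedMatching
      (Fin.cons (fun b => cond b x y) e : Fin (k + 1) → Bool → V) := by
  intro i b j c
  cases i using Fin.cases with
  | zero =>
    cases j using Fin.cases with
    | zero => cases b <;> cases c <;> simp [hxy, hxy.symm]
    | succ j => cases b <;> simp [hx, hy, (Fin.succ_ne_zero j).symm]
  | succ i =>
    cases j using Fin.cases with
    | zero => cases c <;> simp [hx, hy, H.adj_comm (e i b), Fin.succ_ne_zero]
    | succ j => simp [he i b j c]

lemma exists_maximal_isInducedMatching [Fintype V] (H : SimpleGraph V) :
    ∃ (k : ℕ) (e : Fin k → Bool → V), H.IsInducedMatching e ∧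
      ∀ x y, (∀ i b, ¬H.Adj x (e i b)) → (∀ i b, ¬H.Adj y (e i b)) → ¬H.Adj x y := by
  classical
  let P : ℕ → Prop := fun k => ∃ e : Fin k → Bool → V, H.IsInducedMatching e
  have hbound : ∀ k, P k → k ≤ Fintype.card V := by
    rintro k ⟨e, he⟩
    have := Fintype.card_le_of_injective _ he.injective
    simp at this
    omega
  have h0 : P 0 := ⟨fun i => i.elim0, fun i => i.elim0⟩
  obtain ⟨e, he⟩ : P (Nat.findGreatest P (Fintype.card V)) :=
    Nat.findGreatest_spec (Nat.zero_le _) h0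
  refine ⟨_, e, he, fun x y hx hy hxy => ?_⟩
  have h1 : P (Nat.findGreatest P (Fintype.card V) + 1) := ⟨_, he.cons hxy hx hy⟩
  have := Nat.le_findGreatest (hbound _ h1) h1
  omega

lemma EdgePathFree.exists_hasSignature (hP : H.EdgePathFree) (ht : H.TriangleFree)
    {e : ι → Bool → V} (he : H.IsInducedMatching e) {w : V} (hw : ∀ i b, w ≠ e i b)
    {i : ι} {b : Bool} (hb : H.Adj w (e i b)) : ∃ g, H.HasSignature e w g := by
  classical
  have hex : ∀ j, ∃ c, H.Adj w (e j c) := by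
    intro j
    by_contra! hj
    have hij : i ≠ j := by rintro rfl; exact hj _ hb
    have hib : H.Adj (e i b) (e i !b) := (he ..).2 ⟨rfl, by simp⟩
    refine hP (e j true) (e j false) w (e i b) (e i !b) ((he ..).2 ⟨rfl, by simp⟩) hb hib
      (hw _ _) (fun h => ht _ _ _ hb h hib) ?_ ?_ ?_ ?_ ?_ ?_ <;>
    simp [he _ _ _ _, hij.symm, H.adj_comm _ w, hj]
  choose g hg using hex
  refine ⟨g, fun j c => ⟨fun h => ?_, fun h => h ▸ hg j⟩⟩
  by_contra hne
  exact ht _ _ _ (hg j) h ((he ..).2 ⟨rfl, hne⟩)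

lemma HasSignature.ne_of_adj (ht : H.TriangleFree) {e : ι → Bool → V} {w w' : V}
    {g g' : ι → Bool} (hg : H.HasSignature e w g) (hg' : H.HasSignature e w' g')
    (h : H.Adj w w') (i : ι) : g i ≠ g' i := fun hi =>
  ht _ _ _ h ((hg i _).2 rfl) ((hg' i _).2 hi.symm)

lemma HasSignature.adj_of_two_lt_card [Fintype ι] (hP : H.EdgePathFree) {e : ι → Bool → V}
    (he : H.IsInducedMatching e) {w w' : V} {g g' : ι → Bool} (hg : H.HasSignature e w g)
    (hg' : H.HasSignature e w' g')
    (h : 2 < (Finset.univ.filter fun i => g i ≠ g' i).card) : H.Adj w w' := by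
  obtain ⟨i, j, l, hi, hj, hl, hij, hil, hjl⟩ := Finset.two_lt_card_iff.1 h
  simp only [Finset.mem_filter, Finset.mem_univ, true_and] at hi hj hl
  by_contra hww
  refine hP w' (e l (g' l)) (e i (g i)) w (e j (g j)) ((hg' _ _).2 rfl)
    ((hg _ _).2 rfl).symm ((hg _ _).2 rfl) ?_ ?_ ?_ ?_ ?_ ?_ ?_ ?_
  · exact fun h => hij (congrArg Prod.fst (he.injective (a₁ := (i, g i)) (a₂ := (j, g j)) h))
  · simp [he _ _ _ _, hij]
  · exact fun h => hi ((hg' _ _).1 h).symm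
  · exact fun h => hww h.symm
  · exact fun h => hj ((hg' _ _).1 h).symm
  · simp [he _ _ _ _, hil.symm]
  · exact fun h => hl ((hg _ _).1 h.symm)
  · simp [he _ _ _ _, hjl.symm]

lemma HasSignature.adj_of_one_lt_card [Fintype ι] (hP : H.EdgePathFree) {e : ι → Bool → V}
    (he : H.IsInducedMatching e) {w w' x : V} {g g' : ι → Bool} (hg : H.HasSignature e w g)
    (hg' : H.HasSignature e w' g') (hx : ∀ i b, ¬H.Adj x (e i b)) (hxw : H.Adj x w)
    (hww : ¬H.Adj w w')
    (h : 1 < (Finset.univ.filter fun i => g' i ≠ g i).card) : H.Adj x w' := by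
  obtain ⟨i, j, hi, hj, hij⟩ := Finset.one_lt_card_iff.1 h
  simp only [Finset.mem_filter, Finset.mem_univ, true_and] at hi hj
  by_contra hxw'
  refine hP x w (e i (g' i)) w' (e j (g' j)) hxw
    ((hg' _ _).2 rfl).symm ((hg' _ _).2 rfl) ?_ ?_ (hx _ _) hxw' (hx _ _) ?_ hww ?_
  · exact fun h => hij (congrArg Prod.fst (he.injective (a₁ := (i, g' i)) (a₂ := (j, g' j)) h))
  · simp [he _ _ _ _, hij]
  · exact fun h => hi ((hg _ _).1 h).symm
  · exact fun h => hj ((hg _ _).1 h).symm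

lemma card_filter_ne_add_card_filter_ne [Fintype ι] {g g₀ g₁ : ι → Bool}
    (h : ∀ i, g₀ i ≠ g₁ i) :
    (Finset.univ.filter fun i => g i ≠ g₀ i).card +
      (Finset.univ.filter fun i => g i ≠ g₁ i).card = Fintype.card ι := by
  classical
  have : (Finset.univ.filter fun i => g i ≠ g₁ i) = Finset.univ.filter fun i => ¬ g i ≠ g₀ i := by
    ext i
    have := h i
    simp only [Finset.mem_filter, Finset.mem_univ, true_and]
    generalize g i = x at *
    generalize g₀ i = y at *
    generalize g₁ i = z at *
    revert x y z
    decide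
  rw [this, Finset.card_filter_add_card_filter_not, Finset.card_univ]

/-- A triangle-free graph without induced `P₂ ∪ P₃` has at most `3 * α + 1` vertices. -/
lemma EdgePathFree.card_le [Fintype V] (hP : H.EdgePathFree) (ht : H.TriangleFree) (N : ℕ)
    (hN : ∀ T : Finset V, (∀ x ∈ T, ∀ y ∈ T, ¬H.Adj x y) → T.card ≤ N) :
    Fintype.card V ≤ 3 * N + 1 := by
  classical
  obtain ⟨k, e, he, hmax⟩ := exists_maximal_isInducedMatching H
  let S : Finset V := Finset.univ.filter fun v => ∀ i b, ¬H.Adj v (e i b)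
  let W : Finset V := Finset.univ.filter fun v =>
    (∀ i b, v ≠ e i b) ∧ ∃ g, H.HasSignature e v g
  have hS : ∀ x ∈ S, ∀ i b, ¬H.Adj x (e i b) := fun x hx => (Finset.mem_filter.1 hx).2
  have hSS : ∀ x ∈ S, ∀ y ∈ S, ¬H.Adj x y := fun x hx y hy => hmax x y (hS x hx) (hS y hy)
  have hWe : ∀ w ∈ W, ∀ i b, w ≠ e i b := fun w hw => (Finset.mem_filter.1 hw).2.1
  have hW : ∀ w ∈ W, ∃ g, H.HasSignature e w g := fun w hw => (Finset.mem_filter.1 hw).2.2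
  choose! f hf using hW
  have hcard : Fintype.card V ≤ 2 * k + W.card + S.card := by
    have hcover : (Finset.univ : Finset V) ⊆
        (Finset.univ.image (Function.uncurry e) ∪ W) ∪ S := by
      intro v _
      by_cases hv : ∀ i b, ¬H.Adj v (e i b)
      · exact Finset.mem_union_right _ (by simpa [S] using hv)
      · push Not at hv
        obtain ⟨i, b, hb⟩ := hv
        refine Finset.mem_union_left _ ?_
        by_cases hr : ∀ i b, v ≠ e i b
        · exact Finset.mem_union_right _
            (by simpa [W, hr] using hP.exists_hasSignature ht he hr hb)
        · push Not at hr
          obtain ⟨j, c, rfl⟩ := hr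
          exact Finset.mem_union_left _ (Finset.mem_image.2 ⟨(j, c), Finset.mem_univ _, rfl⟩)
    have h1 := Finset.card_le_card hcover
    have h2 := Finset.card_union_le (Finset.univ.image (Function.uncurry e) ∪ W) S
    have h3 := Finset.card_union_le (Finset.univ.image (Function.uncurry e)) W
    have h4 := Finset.card_image_le (s := Finset.univ) (f := Function.uncurry e)
    simp only [Finset.card_univ, Fintype.card_prod, Fintype.card_fin, Fintype.card_bool] at h1 h4
    omega
  -- transversals of the matching extend independent sets that avoid them
  have htrans : ∀ (g : Fin k → Bool) (T : Finset V), (∀ x ∈ T, ∀ y ∈ T, ¬H.Adj x y) →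
      (∀ x ∈ T, ∀ i, ¬H.Adj x (e i (g i))) → (∀ x ∈ T, ∀ i, x ≠ e i (g i)) →
      T.card + k ≤ N := by
    intro g T hT hTg hTe
    have hinj : Function.Injective fun i => e i (g i) := fun i j h =>
      congrArg Prod.fst (he.injective (a₁ := (i, g i)) (a₂ := (j, g j)) h)
    have hd : Disjoint T (Finset.univ.image fun i => e i (g i)) := by
      rw [Finset.disjoint_left]
      intro x hx hx'
      obtain ⟨i, _, rfl⟩ := Finset.mem_image.1 hx'
      exact hTe _ hx i rfl
    have := hN (T ∪ Finset.univ.image fun i => e i (g i)) ?_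
    · rwa [Finset.card_union_of_disjoint hd, Finset.card_image_of_injective _ hinj,
        Finset.card_univ, Fintype.card_fin] at this
    · simp only [Finset.mem_union, Finset.mem_image, Finset.mem_univ, true_and]
      rintro x (hx | ⟨i, rfl⟩) y (hy | ⟨j, rfl⟩)
      · exact hT x hx y hy
      · exact hTg x hx j
      · exact fun h => hTg y hy i h.symm
      · simp only [he _ _ _ _]
        rintro ⟨rfl, h⟩
        exact h rfl
  have hSe : ∀ x ∈ S, ∀ i b, x ≠ e i b := by
    rintro x hx i b rfl
    exact hS _ hx i (!b) ((he ..).2 ⟨rfl, by simp⟩)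
  have hSk : S.card + k ≤ N :=
    htrans (fun _ => true) S hSS (fun x hx i => hS x hx i _) fun x hx i => hSe x hx i _
  obtain rfl | hk := Nat.eq_zero_or_pos k
  · have : W.card ≤ N := by
      refine hN W fun x hx y hy h => ?_
      exact hmax x y (fun i => i.elim0) (fun i => i.elim0) h
    omega
  let i₀ : Fin k := ⟨0, hk⟩
  -- the neighbourhood of an end of the first edge
  have hnbr : ∀ (b : Bool) (T : Finset V), T ⊆ S → (∀ x ∈ T, ∀ w ∈ W, ¬H.Adj x w) →
      (W.filter fun w => f w i₀ = b).card + 1 + T.card ≤ N := by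
    intro b T hT hTW
    have hd : Disjoint (W.filter fun w => f w i₀ = b) T := by
      rw [Finset.disjoint_left]
      intro x hx hx'
      have hxW := (Finset.mem_filter.1 hx).1
      exact hS x (hT hx') i₀ _ ((hf x hxW i₀ _).2 rfl)
    have hn : e i₀ (!b) ∉ (W.filter fun w => f w i₀ = b) ∪ T := by
      rw [Finset.mem_union]
      rintro (h | h)
      · exact hWe _ (Finset.mem_filter.1 h).1 _ _ rfl
      · exact hSe _ (hT h) _ _ rfl
    have := hN (insert (e i₀ (!b)) ((W.filter fun w => f w i₀ = b) ∪ T)) ?_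
    · rw [Finset.card_insert_of_notMem hn, Finset.card_union_of_disjoint hd] at this
      omega
    · have hadj : ∀ x ∈ W.filter fun w => f w i₀ = b, H.Adj x (e i₀ b) := fun x hx =>
        (hf x (Finset.mem_filter.1 hx).1 i₀ b).2 (Finset.mem_filter.1 hx).2
      have hee : H.Adj (e i₀ (!b)) (e i₀ b) := (he ..).2 ⟨rfl, by simp⟩
      have hTe : ∀ x ∈ T, ∀ i c, ¬H.Adj x (e i c) := fun x hx => hS x (hT hx)
      have hTF : ∀ x ∈ T, ∀ w ∈ W.filter fun w => f w i₀ = b, ¬H.Adj x w := fun x hx w hw =>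
        hTW x hx w (Finset.mem_filter.1 hw).1
      intro x hx y hy hxy
      rw [Finset.mem_insert, Finset.mem_union] at hx hy
      rcases hx with rfl | hx | hx <;> rcases hy with rfl | hy | hy
      · exact H.loopless.irrefl _ hxy
      · exact ht _ _ _ hxy hee (hadj y hy)
      · exact hTe y hy _ _ hxy.symm
      · exact ht _ _ _ hxy (hadj x hx) hee
      · exact ht _ _ _ hxy (hadj x hx) (hadj y hy)
      · exact hTF y hy x hx hxy.symm
      · exact hTe x hx _ _ hxy
      · exact hTF x hx y hy hxy
      · exact hSS x (hT hx) y (hT hy) hxy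
  have hWcard : W.card = (W.filter fun w => f w i₀ = true).card +
      (W.filter fun w => f w i₀ = false).card := by
    rw [← Finset.card_filter_add_card_filter_not (s := W) fun w => f w i₀ = true]
    simp
  obtain hk3 | hk4 := Nat.lt_or_ge k 4
  · have h1 := hnbr true ∅ (by simp) (by simp)
    have h2 := hnbr false ∅ (by simp) (by simp)
    simp only [Finset.card_empty] at h1 h2
    omega
  by_cases hind : ∀ x ∈ W, ∀ y ∈ W, ¬H.Adj x y
  · have := hN W hind
    omega
  push Not at hind
  obtain ⟨w₀, hw₀, w₁, hw₁, h01⟩ := hind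
  have hne := (hf w₀ hw₀).ne_of_adj ht (hf w₁ hw₁) h01
  -- a vertex of `W` adjacent to `w` has signature complementary to that of `w`
  have hsig : ∀ w w' v, w ∈ W → w' ∈ W → v ∈ W → H.Adj w w' → H.Adj v w → f v = f w' := by
    intro w w' v hw hw' hv hww hvw
    funext i
    have h1 := (hf w hw).ne_of_adj ht (hf w' hw') hww i
    have h2 := (hf v hv).ne_of_adj ht (hf w hw) hvw i
    generalize f v i = x at *
    generalize f w i = y at *
    generalize f w' i = z at *
    revert x y z
    decide
  have hclass : ∀ w ∈ W, (W.filter fun v => f v = f w).card + k ≤ N := by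
    intro w hw
    refine htrans (fun i => !f w i) _ ?_ ?_ ?_
    · intro x hx y hy hxy
      rw [Finset.mem_filter] at hx hy
      exact (hf x hx.1).ne_of_adj ht (hf y hy.1) hxy i₀ (by rw [hx.2, hy.2])
    · intro x hx i h
      rw [Finset.mem_filter] at hx
      have := (hf x hx.1 i _).1 h
      rw [hx.2] at this
      simp at this
    · exact fun x hx i => hWe x (Finset.mem_filter.1 hx).1 i _
  by_cases hdom : ∀ w ∈ W, H.Adj w w₀ ∨ H.Adj w w₁
  · have hsub : W ⊆ (W.filter fun v => f v = f w₀) ∪ (W.filter fun v => f v = f w₁) := by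
      intro w hw
      rcases hdom w hw with h | h
      · exact Finset.mem_union_right _
          (Finset.mem_filter.2 ⟨hw, hsig w₀ w₁ w hw₀ hw₁ hw h01 h⟩)
      · exact Finset.mem_union_left _
          (Finset.mem_filter.2 ⟨hw, hsig w₁ w₀ w hw₁ hw₀ hw h01.symm h⟩)
    have h1 := (Finset.card_le_card hsub).trans (Finset.card_union_le _ _)
    have h2 := hclass w₀ hw₀
    have h3 := hclass w₁ hw₁
    omega
  push Not at hdom
  obtain ⟨w₂, hw₂, h20, h21⟩ := hdom
  have htwo : ∀ w ∈ W, ¬H.Adj w w₀ → ¬H.Adj w w₁ → k = 4 ∧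
      (Finset.univ.filter fun i => f w i ≠ f w₀ i).card = 2 ∧
      (Finset.univ.filter fun i => f w i ≠ f w₁ i).card = 2 := by
    intro w hw h0 h1
    have hsum := card_filter_ne_add_card_filter_ne (g := f w) hne
    rw [Fintype.card_fin] at hsum
    have h2 := mt ((hf w hw).adj_of_two_lt_card hP he (hf w₀ hw₀)) h0
    have h3 := mt ((hf w hw).adj_of_two_lt_card hP he (hf w₁ hw₁)) h1
    omega
  obtain ⟨hk', hd0, hd1⟩ := htwo w₂ hw₂ h20 h21
  have hfar : ∀ x ∈ S, ∀ w ∈ W, ¬H.Adj w w₀ → ¬H.Adj w w₁ → ¬H.Adj x w := by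
    intro x hx w hw h0 h1 hxw
    obtain ⟨_, hc0, hc1⟩ := htwo w hw h0 h1
    simp only [ne_comm (a := f w _)] at hc0 hc1
    exact ht x w₀ w₁
      ((hf w hw).adj_of_one_lt_card hP he (hf w₀ hw₀) (hS x hx) hxw h0 (by omega))
      ((hf w hw).adj_of_one_lt_card hP he (hf w₁ hw₁) (hS x hx) hxw h1 (by omega)) h01
  have hSW₂ : ∀ x ∈ S, ∀ w ∈ W, ∀ w', f w = f w' →
      (Finset.univ.filter fun i => f w₂ i ≠ f w' i).card = 2 → ¬H.Adj x w := by
    intro x hx w hw w' hww' hc hxw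
    rw [← hww'] at hc
    have hnot : ¬H.Adj w w₂ := by
      intro h
      have hall := (hf w₂ hw₂).ne_of_adj ht (hf w hw) h.symm
      have : (Finset.univ.filter fun i => f w₂ i ≠ f w i) = Finset.univ :=
        Finset.filter_true_of_mem fun i _ => hall i
      rw [this, Finset.card_univ, Fintype.card_fin] at hc
      omega
    exact hfar x hx w₂ hw₂ h20 h21
      ((hf w hw).adj_of_one_lt_card hP he (hf w₂ hw₂) (hS x hx) hxw hnot (by omega))
  have hSW : ∀ x ∈ S, ∀ w ∈ W, ¬H.Adj x w := by
    intro x hx w hw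
    by_cases h0 : H.Adj w w₀
    · exact hSW₂ x hx w hw w₁ (hsig w₀ w₁ w hw₀ hw₁ hw h01 h0) hd1
    by_cases h1 : H.Adj w w₁
    · exact hSW₂ x hx w hw w₀ (hsig w₁ w₀ w hw₁ hw₀ hw h01.symm h1) hd0
    exact hfar x hx w hw h0 h1
  have h1 := hnbr true S subset_rfl hSW
  have h2 := hnbr false S subset_rfl hSW
  have h3 := hclass w₀ hw₀
  have h4 : 0 < (W.filter fun v => f v = f w₀).card :=
    Finset.card_pos.2 ⟨w₀, Finset.mem_filter.2 ⟨hw₀, rfl⟩⟩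
  omega

lemma edgePathFree_compl {G : SimpleGraph V} (hpara : ¬ Nonempty (paraglider ↪g G)) :
    Gᶜ.EdgePathFree := by
  intro a b c d e hab hcd hde hce hce' hac had hae hbc hbd hbe
  have nac : a ≠ c := by rintro rfl; exact had hcd
  have nad : a ≠ d := by rintro rfl; exact hac hcd.symm
  have nae : a ≠ e := by rintro rfl; exact had hde.symm
  have nbc : b ≠ c := by rintro rfl; exact hbd hcd
  have nbd : b ≠ d := by rintro rfl; exact hbc hcd.symm
  have nbe : b ≠ e := by rintro rfl; exact hbd hde.symm
  have of_compl : ∀ {x y : V}, x ≠ y → ¬Gᶜ.Adj x y → G.Adj x y := fun hn h => by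
    by_contra h'
    exact h ⟨hn, h'⟩
  replace hce' := of_compl hce hce'
  replace hac := of_compl nac hac
  replace had := of_compl nad had
  replace hae := of_compl nae hae
  replace hbc := of_compl nbc hbc
  replace hbd := of_compl nbd hbd
  replace hbe := of_compl nbe hbe
  obtain ⟨nab, hab⟩ := hab
  obtain ⟨ncd, hcd⟩ := hcd
  obtain ⟨nde, hde⟩ := hde
  refine hpara ⟨⟨⟨![a, c, b, d, e], ?_⟩, ?_⟩⟩
  · intro i j
    fin_cases i <;> fin_cases j <;>
    simp [nac, nad, nae, nbc, nbd, nbe, nab, ncd, nde, hce, nac.symm, nad.symm, nae.symm,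
      nbc.symm, nbd.symm, nbe.symm, nab.symm, ncd.symm, nde.symm, hce.symm]
  · intro i j
    change G.Adj (![a, c, b, d, e] i) (![a, c, b, d, e] j) ↔ _
    fin_cases i <;> fin_cases j <;>
    simp [paraglider, hac, had, hae, hbc, hbd, hbe, hab, hcd, hde, hce', hac.symm, had.symm,
      hae.symm, hbc.symm, hbd.symm, hbe.symm, hce'.symm, G.adj_comm b a, G.adj_comm d c,
      G.adj_comm e d]

end SimpleGraph

/-- If `G` is a finite simple graph on `n` vertices with no independent set of size 3
(`3K1`-free) and with no induced paraglider, then `3 * ω(G) ≥ n - 1`. -/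
theorem stmt1 {V : Type*} [Fintype V] (G : SimpleGraph V)
    (h3K1 : ∀ a b c : V, a ≠ b → a ≠ c → b ≠ c →
      ¬G.Adj a b → ¬G.Adj a c → ¬G.Adj b c → False)
    (hpara : ¬ Nonempty (paraglider ↪g G)) :
    3 * G.cliqueNum ≥ Fintype.card V - 1 := by
  have ht : Gᶜ.TriangleFree := fun a b c hab hac hbc =>
    h3K1 a b c hab.1 hac.1 hbc.1 hab.2 hac.2 hbc.2
  have := (edgePathFree_compl hpara).card_le ht G.cliqueNum fun T hT => by
    refine IsClique.card_le_cliqueNum (t := T) (tc := fun x hx y hy hxy => ?_)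
    by_contra h
    exact hT x hx y hy ⟨hxy, h⟩
  omega
end

section
/- For every i ∈ {1,...,5}, the set A_i contains at most one vertex, i.e. |A_i| ≤ 1. -/
open SimpleGraph

/-- The disjoint union `P2 ∪ P3`: an edge 0-1 together with a path 2-3-4. -/
def p2p3 : SimpleGraph (Fin 5) :=
  SimpleGraph.fromEdgeSet {s(0,1), s(2,3), s(3,4)}

variable {V : Type*}

/-- `S0` is the vertex set of the induced 5-cycle. -/
def S0 (v : Fin 5 → V) : Set V := Set.range v

/-- `Aset H v i` is the set of vertices outside `S0` whose neighborhood in `S0`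
is exactly `{v i}`. -/
def Aset (H : SimpleGraph V) (v : Fin 5 → V) (i : Fin 5) : Set V :=
  {x | x ∉ S0 v ∧ ∀ j : Fin 5, H.Adj x (v j) ↔ j = i}

/-- `Bset H v i` is the set of vertices outside `S0` whose neighborhood in `S0`
is exactly `{v (i-1), v (i+1)}`. -/
def Bset (H : SimpleGraph V) (v : Fin 5 → V) (i : Fin 5) : Set V :=
  {x | x ∉ S0 v ∧ ∀ j : Fin 5, H.Adj x (v j) ↔ (j = i - 1 ∨ j = i + 1)}

/-- `S2set H v` is the set of vertices at distance exactly 2 from `S0`: vertices outside `S0`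
with no neighbor in `S0` but with a neighbor having a neighbor in `S0`. -/
def S2set (H : SimpleGraph V) (v : Fin 5 → V) : Set V :=
  {x | x ∉ S0 v ∧ (∀ j : Fin 5, ¬ H.Adj x (v j)) ∧
    ∃ y, H.Adj x y ∧ ∃ j : Fin 5, H.Adj y (v j)}

/-- `S` is complete to `T`: every vertex of `S` is adjacent to every vertex of `T`. -/
def Complete (H : SimpleGraph V) (S T : Set V) : Prop := ∀ x ∈ S, ∀ y ∈ T, H.Adj x y

/-- `S` is anticomplete to `T`: there are no edges between `S` and `T`. -/
def Anticomplete (H : SimpleGraph V) (S T : Set V) : Prop := ∀ x ∈ S, ∀ y ∈ T, ¬ H.Adj x y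

/-- `hA` is the number of indices `i` with `A_i` nonempty. -/
noncomputable def hA (H : SimpleGraph V) (v : Fin 5 → V) : ℕ :=
  {i : Fin 5 | (Aset H v i).Nonempty}.ncard

/-- `hB` is the number of indices `i` with `B_i` nonempty. -/
noncomputable def hB (H : SimpleGraph V) (v : Fin 5 → V) : ℕ :=
  {i : Fin 5 | (Bset H v i).Nonempty}.ncard

/-- An edge `a b` and a path `c d e` with no other edges among these vertices form an induced
copy of `P2 ∪ P3`. -/
theorem nonempty_p2p3_embedding {V : Type*} {H : SimpleGraph V} {a b c d e : V}
    (hab : H.Adj a b) (hcd : H.Adj c d) (hde : H.Adj d e) (hne : c ≠ e) (hce : ¬ H.Adj c e)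
    (hac : ¬ H.Adj a c) (had : ¬ H.Adj a d) (hae : ¬ H.Adj a e)
    (hbc : ¬ H.Adj b c) (hbd : ¬ H.Adj b d) (hbe : ¬ H.Adj b e) :
    Nonempty (p2p3 ↪g H) := by
  have hab' := hab.ne
  have hcd' := hcd.ne
  have hde' := hde.ne
  have hac' : a ≠ c := by rintro rfl; exact had hcd
  have had' : a ≠ d := by rintro rfl; exact hae hde
  have hae' : a ≠ e := by rintro rfl; exact had hde.symm
  have hbc' : b ≠ c := by rintro rfl; exact hbd hcd
  have hbd' : b ≠ d := by rintro rfl; exact hbe hde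
  have hbe' : b ≠ e := by rintro rfl; exact hbd hde.symm
  refine ⟨⟨⟨![a, b, c, d, e], ?_⟩, ?_⟩⟩
  · intro i j hij
    fin_cases i <;> fin_cases j <;> simp_all [eq_comm]
  · intro i j
    change H.Adj (![a, b, c, d, e] i) (![a, b, c, d, e] j) ↔ _
    fin_cases i <;> fin_cases j <;> simp_all [p2p3, H.adj_comm]

theorem stmt3 {V : Type*} [Fintype V] (H : SimpleGraph V) (v : Fin 5 → V)
    (hinj : Function.Injective v)
    (hC5 : ∀ i j : Fin 5, H.Adj (v i) (v j) ↔ (j = i + 1 ∨ i = j + 1))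
    (htriangle : H.CliqueFree 3)
    (hP2P3 : ¬ Nonempty (p2p3 ↪g H))
    : ∀ i : Fin 5, (Aset H v i).ncard ≤ 1 := by
  intro i
  rw [Set.ncard_le_one (Set.toFinite _)]
  rintro x ⟨-, hx⟩ y ⟨-, hy⟩
  by_contra hxy
  have hxi : H.Adj x (v i) := (hx i).2 rfl
  have hyi : H.Adj y (v i) := (hy i).2 rfl
  have hadj : ¬ H.Adj x y := fun h => by
    classical
    exact htriangle {x, y, v i} (SimpleGraph.is3Clique_triple_iff.2 ⟨h, hxi, hyi⟩)
  refine hP2P3 (nonempty_p2p3_embedding (a := v (i + 2)) (b := v (i + 3))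
    ?_ hxi hyi.symm hxy hadj ?_ ?_ ?_ ?_ ?_ ?_)
  all_goals first
    | rw [hC5]
    | rw [H.adj_comm, hx]
    | rw [H.adj_comm, hy]
  all_goals
    clear * -
    revert i
    decide
end

section
/- For every i ∈ {1,...,5} (indices modulo 5), A_i is anticomplete to A_{i+1}, and A_i is complete to A_{i+2}. -/
open SimpleGraph

variable {V : Type*}

theorem stmt5 {V : Type*} [Fintype V] (H : SimpleGraph V) (v : Fin 5 → V)
    (hinj : Function.Injective v)
    (hC5 : ∀ i j : Fin 5, H.Adj (v i) (v j) ↔ (j = i + 1 ∨ i = j + 1))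
    (htriangle : H.CliqueFree 3)
    (hP2P3 : ¬ Nonempty (p2p3 ↪g H))
    : ∀ i : Fin 5,
      Anticomplete H (Aset H v i) (Aset H v (i + 1)) ∧
      Complete H (Aset H v i) (Aset H v (i + 2)) := by
  intro i
  constructor
  · rintro x ⟨-, hx⟩ y ⟨-, hy⟩ hxy
    refine hP2P3 (nonempty_p2p3_embedding (a := x) (b := y) (c := v (i + 2)) (d := v (i + 3))
      (e := v (i + 4)) hxy ?_ ?_ ?_ ?_ ?_ ?_ ?_ ?_ ?_ ?_) <;>
    simp only [hx, hy, hC5, hinj.ne_iff, ne_eq] <;> clear hx hy <;> revert i <;> decide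
  · rintro x ⟨hx', hx⟩ y ⟨-, hy⟩
    by_contra hxy
    refine hP2P3 (nonempty_p2p3_embedding (a := y) (b := v (i + 2)) (c := x) (d := v i)
      (e := v (i + 4)) ?_ ?_ ?_ ?_ ?_ (fun h => hxy h.symm) ?_ ?_ ?_ ?_ ?_)
    case refine_4 => exact fun h => hx' ⟨_, h.symm⟩
    all_goals
      simp only [hx, hy, hC5, H.adj_comm (v (i + 2)) x] <;>
      clear hx hy hxy hx' <;> revert i <;> decide
end

section
/- For every i ∈ {1,...,5} (indices modulo 5), B_i is anticomplete to B_{i+2}. -/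
open SimpleGraph

variable {V : Type*}

theorem stmt7 {V : Type*} [Fintype V] (H : SimpleGraph V) (v : Fin 5 → V)
    (hinj : Function.Injective v)
    (hC5 : ∀ i j : Fin 5, H.Adj (v i) (v j) ↔ (j = i + 1 ∨ i = j + 1))
    (htriangle : H.CliqueFree 3)
    (hP2P3 : ¬ Nonempty (p2p3 ↪g H))
    : ∀ i : Fin 5, Anticomplete H (Bset H v i) (Bset H v (i + 2)) := by
  intro i x hx y hy hxy
  have hxv : H.Adj x (v (i + 1)) := (hx.2 (i + 1)).2 (Or.inr rfl)
  have hi : ∀ k : Fin 5, k + 1 = k + 2 - 1 := by decide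
  have hyv : H.Adj y (v (i + 1)) := (hy.2 (i + 1)).2 (Or.inl (hi i))
  classical
  exact htriangle _ (is3Clique_triple_iff.2 ⟨hxy, hxv, hyv⟩)
end

section
/- For every i ∈ {1,...,5} (indices modulo 5), every vertex b ∈ B_i and every j ∈ {i−1, i+1}, b is adjacent to all but at most one vertex of B_j, i.e. |N(b) ∩ B_j| ≥ |B_j| − 1. -/
open SimpleGraph

variable {V : Type*}

/-- Two distinct vertices with a common neighbor `w`, both anticomplete to an edge `ab` that is
itself anticomplete to `w`, contradict `P2 ∪ P3`-freeness in a triangle-free graph. -/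
theorem eq_of_common_neighbor_of_edge {V : Type*} {H : SimpleGraph V}
    (htriangle : H.CliqueFree 3) (hP2P3 : ¬ Nonempty (p2p3 ↪g H)) {a b c w d : V}
    (hab : H.Adj a b) (hcw : H.Adj c w) (hdw : H.Adj d w)
    (hac : ¬ H.Adj a c) (haw : ¬ H.Adj a w) (had : ¬ H.Adj a d)
    (hbc : ¬ H.Adj b c) (hbw : ¬ H.Adj b w) (hbd : ¬ H.Adj b d) : c = d := by
  classical
  by_contra hne
  refine hP2P3 (nonempty_p2p3_embedding hab hcw hdw.symm hne (fun hcd => ?_)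
    hac haw had hbc hbw hbd)
  exact htriangle {c, w, d} (is3Clique_triple_iff.2 ⟨hcw, hcd, hdw.symm⟩)

theorem eq_of_mem_Bset_of_not_adj {V : Type*} {H : SimpleGraph V} {v : Fin 5 → V}
    (hC5 : ∀ i j : Fin 5, H.Adj (v i) (v j) ↔ (j = i + 1 ∨ i = j + 1))
    (htriangle : H.CliqueFree 3) (hP2P3 : ¬ Nonempty (p2p3 ↪g H))
    {i j : Fin 5} (hj : j = i - 1 ∨ j = i + 1) {b c d : V} (hb : b ∈ Bset H v i)
    (hc : c ∈ Bset H v j) (hd : d ∈ Bset H v j) (hbc : ¬ H.Adj b c) (hbd : ¬ H.Adj b d) :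
    c = d := by
  obtain ⟨k, l, hbk, hbl, hjk, hjl, hkl⟩ : ∃ k l : Fin 5, (k = i - 1 ∨ k = i + 1) ∧
      ¬ (l = i - 1 ∨ l = i + 1) ∧ ¬ (k = j - 1 ∨ k = j + 1) ∧ (l = j - 1 ∨ l = j + 1) ∧
      ¬ (l = k + 1 ∨ k = l + 1) := by
    clear * - hj
    revert i j
    decide
  exact eq_of_common_neighbor_of_edge htriangle hP2P3 (b := v k) (w := v l)
    ((hb.2 k).2 hbk) ((hc.2 l).2 hjl) ((hd.2 l).2 hjl) hbc (fun h => hbl ((hb.2 l).1 h)) hbd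
    (fun h => hjk ((hc.2 k).1 h.symm)) (fun h => hkl ((hC5 k l).1 h))
    (fun h => hjk ((hd.2 k).1 h.symm))

theorem stmt8 {V : Type*} [Fintype V] (H : SimpleGraph V) (v : Fin 5 → V)
    (hinj : Function.Injective v)
    (hC5 : ∀ i j : Fin 5, H.Adj (v i) (v j) ↔ (j = i + 1 ∨ i = j + 1))
    (htriangle : H.CliqueFree 3)
    (hP2P3 : ¬ Nonempty (p2p3 ↪g H))
    : ∀ i : Fin 5, ∀ b ∈ Bset H v i, ∀ j : Fin 5, (j = i - 1 ∨ j = i + 1) →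
      (H.neighborSet b ∩ Bset H v j).ncard ≥ (Bset H v j).ncard - 1 := by
  intro i b hb j hj
  have hle : (Bset H v j \ H.neighborSet b).ncard ≤ 1 :=
    (Set.ncard_le_one_iff (Set.toFinite _)).2 fun hc hd =>
      eq_of_mem_Bset_of_not_adj hC5 htriangle hP2P3 hj hb hc.1 hd.1 hc.2 hd.2
  have hsum := Set.ncard_inter_add_ncard_sdiff_eq_ncard (Bset H v j) (H.neighborSet b)
  rw [Set.inter_comm]
  omega
end

section
/- Every vertex of H that is connected to S0 by a path lies at distance at most 2 from S0 (there is no vertex at distance 3 or more from S0 in its component), and the set S2 is an independent set of H. -/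
open SimpleGraph

variable {V : Type*}

/-- In a `P2 ∪ P3`-free graph, every edge has an endpoint with a neighbor on a given induced
5-cycle. -/
theorem exists_adj_cycle_of_adj {V : Type*} (H : SimpleGraph V) (v : Fin 5 → V)
    (hinj : Function.Injective v)
    (hC5 : ∀ i j : Fin 5, H.Adj (v i) (v j) ↔ (j = i + 1 ∨ i = j + 1))
    (hP2P3 : ¬ Nonempty (p2p3 ↪g H)) {x y : V} (hxy : H.Adj x y) :
    ∃ j : Fin 5, H.Adj x (v j) ∨ H.Adj y (v j) := by
  by_contra! h
  have hx (j : Fin 5) : x ≠ v j := fun e => (h (j + 1)).1 (e ▸ (hC5 j (j + 1)).2 (Or.inl rfl))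
  have hy (j : Fin 5) : y ≠ v j := fun e => (h (j + 1)).2 (e ▸ (hC5 j (j + 1)).2 (Or.inl rfl))
  have hx' (j : Fin 5) : ¬ H.Adj (v j) x := fun e => (h j).1 e.symm
  have hy' (j : Fin 5) : ¬ H.Adj (v j) y := fun e => (h j).2 e.symm
  refine hP2P3 ⟨⟨⟨![x, y, v 0, v 1, v 2], ?_⟩, ?_⟩⟩
  · intro i j hij
    fin_cases i <;> fin_cases j <;>
      simp [hx, hy, (hx _).symm, (hy _).symm, hxy.ne, hxy.ne.symm, hinj.eq_iff] at hij ⊢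
  · intro i j
    change H.Adj (![x, y, v 0, v 1, v 2] i) (![x, y, v 0, v 1, v 2] j) ↔ p2p3.Adj i j
    fin_cases i <;> fin_cases j <;>
      simp [p2p3, h, hx', hy', hxy, hxy.symm, hC5]

theorem stmt10 {V : Type*} [Fintype V] (H : SimpleGraph V) (v : Fin 5 → V)
    (hinj : Function.Injective v)
    (hC5 : ∀ i j : Fin 5, H.Adj (v i) (v j) ↔ (j = i + 1 ∨ i = j + 1))
    (htriangle : H.CliqueFree 3)
    (hP2P3 : ¬ Nonempty (p2p3 ↪g H))
    : (∀ x : V, (∃ j : Fin 5, H.Reachable x (v j)) → ∃ j : Fin 5, H.dist x (v j) ≤ 2) ∧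
      (∀ x ∈ S2set H v, ∀ y ∈ S2set H v, ¬ H.Adj x y) := by
  have key {x y : V} (hxy : H.Adj x y) := exists_adj_cycle_of_adj H v hinj hC5 hP2P3 hxy
  refine ⟨?_, ?_⟩
  · rintro x ⟨j, ⟨p⟩⟩
    cases p with
    | nil => exact ⟨j, by simp⟩
    | cons hxy _ =>
      obtain ⟨k, hk | hk⟩ := key hxy
      · exact ⟨k, (dist_le hk.toWalk).trans (by simp)⟩
      · exact ⟨k, (dist_le (Walk.cons hxy hk.toWalk)).trans (by simp)⟩
  · rintro x ⟨-, hx, -⟩ y ⟨-, hy, -⟩ hxy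
    obtain ⟨k, hk | hk⟩ := key hxy
    · exact hx k hk
    · exact hy k hk
end

section
/- Suppose S2 ≠ ∅. If for some i ∈ {1,...,5} (indices modulo 5) both B_i and B_{i+2} are nonempty and there is at least one edge between B_i ∪ B_{i+2} and S2, then |B_i| = |B_{i+2}| = 1 and there exists a vertex z ∈ S2 such that the set of neighbors of B_i in S2 and the set of neighbors of B_{i+2} in S2 are both equal to {z}. -/
open SimpleGraph

variable {V : Type*}

/-- An edge `a b` and an induced path `c d e`, with no edges between them, cannot coexist. -/
lemma false_of_edge_of_path {H : SimpleGraph V} (hP : ¬ Nonempty (p2p3 ↪g H)) {a b c d e : V}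
    (hab : H.Adj a b) (hcd : H.Adj c d) (hde : H.Adj d e) (hne : c ≠ e) (hce : ¬ H.Adj c e)
    (hac : ¬ H.Adj a c) (had : ¬ H.Adj a d) (hae : ¬ H.Adj a e)
    (hbc : ¬ H.Adj b c) (hbd : ¬ H.Adj b d) (hbe : ¬ H.Adj b e) : False := by
  have hmap : ∀ i j : Fin 5, H.Adj (![a, b, c, d, e] i) (![a, b, c, d, e] j) ↔ p2p3.Adj i j := by
    intro i j
    fin_cases i <;> fin_cases j <;> simp [p2p3, *, H.adj_comm]
  have hinj : Function.Injective ![a, b, c, d, e] := by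
    intro i j hij
    fin_cases i <;> fin_cases j <;> simp at hij ⊢ <;> grind [H.adj_comm, H.irrefl]
  exact hP ⟨⟨⟨_, hinj⟩, hmap _ _⟩⟩

lemma adj_of_mem_Bset {H : SimpleGraph V} {v : Fin 5 → V} {k : Fin 5} {x : V}
    (hx : x ∈ Bset H v k) :
    ¬ H.Adj x (v k) ∧ H.Adj x (v (k + 1)) ∧ ¬ H.Adj x (v (k + 2)) ∧
      ¬ H.Adj x (v (k + 3)) ∧ H.Adj x (v (k + 4)) := by
  simp only [hx.2]
  clear hx
  revert k
  decide

/-- Two vertices of `S2` are never adjacent. -/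
lemma not_adj_of_mem_S2set {H : SimpleGraph V} {v : Fin 5 → V} (hinj : Function.Injective v)
    (hC5 : ∀ i j : Fin 5, H.Adj (v i) (v j) ↔ (j = i + 1 ∨ i = j + 1))
    (hP : ¬ Nonempty (p2p3 ↪g H)) {y z : V} (hy : y ∈ S2set H v) (hz : z ∈ S2set H v) :
    ¬ H.Adj y z := fun h =>
  false_of_edge_of_path hP h ((hC5 0 1).2 (by decide)) ((hC5 1 2).2 (by decide))
    (hinj.ne (by decide)) (by rw [hC5]; decide) (hy.2.1 _) (hy.2.1 _) (hy.2.1 _)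
    (hz.2.1 _) (hz.2.1 _) (hz.2.1 _)

lemma adj_add_two_add_three {H : SimpleGraph V} {v : Fin 5 → V}
    (hC5 : ∀ i j : Fin 5, H.Adj (v i) (v j) ↔ (j = i + 1 ∨ i = j + 1)) (k : Fin 5) :
    H.Adj (v (k + 2)) (v (k + 3)) := by
  rw [hC5]
  revert k
  decide

/-- A vertex of `B_k` has at most one neighbor in `S2`. -/
lemma S2set_neighbor_unique {H : SimpleGraph V} {v : Fin 5 → V} (hinj : Function.Injective v)
    (hC5 : ∀ i j : Fin 5, H.Adj (v i) (v j) ↔ (j = i + 1 ∨ i = j + 1))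
    (hP : ¬ Nonempty (p2p3 ↪g H)) {k : Fin 5} {b y z : V} (hb : b ∈ Bset H v k)
    (hy : y ∈ S2set H v) (hz : z ∈ S2set H v) (hby : H.Adj b y) (hbz : H.Adj b z) : y = z := by
  by_contra hne
  obtain ⟨-, -, h2, h3, -⟩ := adj_of_mem_Bset hb
  exact false_of_edge_of_path hP (adj_add_two_add_three hC5 k) hby.symm hbz hne
    (not_adj_of_mem_S2set hinj hC5 hP hy hz) (fun h => hy.2.1 _ h.symm) (fun h => h2 h.symm)
    (fun h => hz.2.1 _ h.symm) (fun h => hy.2.1 _ h.symm) (fun h => h3 h.symm)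
    (fun h => hz.2.1 _ h.symm)

/-- In a triangle-free graph, two vertices with a common neighbor are not adjacent. -/
lemma not_adj_of_common_neighbor {H : SimpleGraph V} (htriangle : H.CliqueFree 3) {a b c : V}
    (hac : H.Adj a c) (hbc : H.Adj b c) : ¬ H.Adj a b := by
  classical
  exact fun hab => htriangle _ (is3Clique_triple_iff.2 ⟨hab, hac, hbc⟩)

/-- A vertex of `S2` has at most one neighbor in `B_k`. -/
lemma Bset_neighbor_unique {H : SimpleGraph V} {v : Fin 5 → V}
    (hC5 : ∀ i j : Fin 5, H.Adj (v i) (v j) ↔ (j = i + 1 ∨ i = j + 1))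
    (htriangle : H.CliqueFree 3) (hP : ¬ Nonempty (p2p3 ↪g H)) {k : Fin 5} {a b z : V}
    (ha : a ∈ Bset H v k) (hb : b ∈ Bset H v k)
    (hz : z ∈ S2set H v) (haz : H.Adj a z) (hbz : H.Adj b z) : a = b := by
  by_contra hne
  obtain ⟨-, -, a2, a3, -⟩ := adj_of_mem_Bset ha
  obtain ⟨-, -, b2, b3, -⟩ := adj_of_mem_Bset hb
  exact false_of_edge_of_path hP (adj_add_two_add_three hC5 k) haz hbz.symm hne
    (not_adj_of_common_neighbor htriangle haz hbz)
    (fun h => a2 h.symm) (fun h => hz.2.1 _ h.symm) (fun h => b2 h.symm)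
    (fun h => a3 h.symm) (fun h => hz.2.1 _ h.symm) (fun h => b3 h.symm)

/-- Let `z` in `S2` have a neighbor `b` that sees neither end of the edge `v p v q`. Then `z` is
adjacent to every vertex outside `S0` that sees `v p` but not `v q` and shares a neighbor
with `b`. -/
lemma adj_of_mem_S2set_of_path {H : SimpleGraph V} {v : Fin 5 → V}
    (htriangle : H.CliqueFree 3) (hP : ¬ Nonempty (p2p3 ↪g H)) {b c u z : V} {p q : Fin 5}
    (hz : z ∈ S2set H v) (hbz : H.Adj b z) (hbp : ¬ H.Adj b (v p)) (hbq : ¬ H.Adj b (v q))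
    (hpq : H.Adj (v p) (v q)) (hcp : H.Adj c (v p)) (hcq : ¬ H.Adj c (v q)) (hc : c ∉ S0 v)
    (hbu : H.Adj b u) (hcu : H.Adj c u) : H.Adj c z := by
  by_contra h
  exact false_of_edge_of_path hP hbz hcp hpq (fun e => hc ⟨q, e.symm⟩) hcq
    (not_adj_of_common_neighbor htriangle hbu hcu) hbp hbq
    (fun e => h e.symm) (hz.2.1 _) (hz.2.1 _)

theorem stmt13 {V : Type*} [Fintype V] (H : SimpleGraph V) (v : Fin 5 → V)
    (hinj : Function.Injective v)
    (hC5 : ∀ i j : Fin 5, H.Adj (v i) (v j) ↔ (j = i + 1 ∨ i = j + 1))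
    (htriangle : H.CliqueFree 3)
    (hP2P3 : ¬ Nonempty (p2p3 ↪g H))
    (hS2 : (S2set H v).Nonempty)
    : ∀ i : Fin 5, (Bset H v i).Nonempty → (Bset H v (i + 2)).Nonempty →
      (∃ b ∈ Bset H v i ∪ Bset H v (i + 2), ∃ z ∈ S2set H v, H.Adj b z) →
      (Bset H v i).ncard = 1 ∧ (Bset H v (i + 2)).ncard = 1 ∧
      ∃ z ∈ S2set H v,
        {w ∈ S2set H v | ∃ b ∈ Bset H v i, H.Adj b w} = {z} ∧
        {w ∈ S2set H v | ∃ b ∈ Bset H v (i + 2), H.Adj b w} = {z} := by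
  have key : ∀ i z, z ∈ S2set H v → ∀ b ∈ Bset H v i, ∀ c ∈ Bset H v (i + 2),
      (H.Adj b z ↔ H.Adj c z) := by
    intro i
    have e1 : i + 2 + 1 = i + 3 := by revert i; decide
    have e3 : i + 2 + 3 = i := by revert i; decide
    have e2 : i + 2 + 2 = i + 4 := by revert i; decide
    have e4 : i + 2 + 4 = i + 1 := by revert i; decide
    have h40 : H.Adj (v (i + 4)) (v i) := by
      rw [hC5]; revert i; decide
    intro z hz b hb c hc
    obtain ⟨b0, b1, b2, b3, b4⟩ := adj_of_mem_Bset hb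
    obtain ⟨c2, c3, c4, c0, c1⟩ := adj_of_mem_Bset hc
    rw [e1] at c3
    rw [e2] at c4
    rw [e3] at c0
    rw [e4] at c1
    exact ⟨fun h => adj_of_mem_S2set_of_path htriangle hP2P3 hz h b3 b2
        (adj_add_two_add_three hC5 i).symm c3 c2 hc.1 b1 c1,
      fun h => adj_of_mem_S2set_of_path htriangle hP2P3 hz h c4 c0 h40 b4 b0 hb.1 c1 b1⟩
  rintro i ⟨b, hb⟩ ⟨c, hc⟩ ⟨x, hx, z, hz, hxz⟩
  have hbz : H.Adj b z := by
    rcases hx with hx | hx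
    · exact (key i z hz b hb c hc).2 ((key i z hz x hx c hc).1 hxz)
    · exact (key i z hz b hb x hx).2 hxz
  have hcz : H.Adj c z := (key i z hz b hb c hc).1 hbz
  have hB : ∀ a ∈ Bset H v i, H.Adj a z := fun a ha => (key i z hz a ha c hc).2 hcz
  have hC : ∀ a ∈ Bset H v (i + 2), H.Adj a z := fun a ha => (key i z hz b hb a ha).1 hbz
  refine ⟨Set.ncard_eq_one.2 ⟨b, Set.eq_singleton_iff_unique_mem.2 ⟨hb, fun a ha =>
      Bset_neighbor_unique hC5 htriangle hP2P3 ha hb hz (hB a ha) hbz⟩⟩,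
    Set.ncard_eq_one.2 ⟨c, Set.eq_singleton_iff_unique_mem.2 ⟨hc, fun a ha =>
      Bset_neighbor_unique hC5 htriangle hP2P3 ha hc hz (hC a ha) hcz⟩⟩,
    z, hz, Set.eq_singleton_iff_unique_mem.2 ⟨⟨hz, b, hb, hbz⟩, ?_⟩,
    Set.eq_singleton_iff_unique_mem.2 ⟨⟨hz, c, hc, hcz⟩, ?_⟩⟩
  · rintro w ⟨hw, a, ha, haw⟩
    exact S2set_neighbor_unique hinj hC5 hP2P3 ha hw hz haw (hB a ha)
  · rintro w ⟨hw, a, ha, haw⟩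
    exact S2set_neighbor_unique hinj hC5 hP2P3 ha hw hz haw (hC a ha)
end
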